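/- arXiv:2602.02364 — 3 statements merged into one kernel-verified Lean document; each statement's English description precedes it below -/
import Mathlib

section
/- Let X be a set with an adjacency relation, Y a measurable space, and A a mechanism assigning to each x ∈ X a probability measure A(x) on Y that satisfies (ε, δ)-DP, i.e. D_{e^ε}(A(x)‖A(x')) ≤ δ for all adjacent x, x', where ε ≥ 0 and δ ∈ [0,1]. Let d ≥ 1, let f_enc : Y → (density matrices on ℂ^d) be measurable, let {E_k}_{k=1}^K be a POVM on ℂ^d, and let η ∈ [0,1]. Define the composed mechanism M(x) to be the probability vector on {1,…,K} given by M(x)(k) = ∫_Y Tr[E_k ((1-η) f_enc(y) + η I/d)] dA(x)(y). Then for all adjacent x, x': Σ_{k=1}^K max(0, M(x)(k) − e^ε M(x')(k)) ≤ max(0, η(1 − e^ε)/d + (1 − η)δ). In other words, the composed mechanism satisfies (ε, δ')-DP with δ' = [η(1 − e^ε)/d + (1 − η)δ]₊. -/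
open MeasureTheory Matrix
open scoped ComplexOrder

/-- The hockey-stick inequality for events extends to functions with values in `[0, c]`. -/
theorem integral_le_mul_integral_add_of_measureReal_le {Y : Type*} [MeasurableSpace Y]
    {μ ν : Measure Y} [IsFiniteMeasure μ] [IsFiniteMeasure ν] {a δ c : ℝ}
    (h : ∀ S, MeasurableSet S → μ.real S ≤ a * ν.real S + δ) {g : Y → ℝ} (hg : Measurable g)
    (hg0 : ∀ y, 0 ≤ g y) (hgc : ∀ y, g y ≤ c) (hc : 0 ≤ c) :
    ∫ y, g y ∂μ ≤ a * ∫ y, g y ∂ν + c * δ := by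
  have hint (κ : Measure Y) [IsFiniteMeasure κ] : Integrable g κ :=
    .of_bound hg.aestronglyMeasurable c (.of_forall fun y => by
      rw [Real.norm_of_nonneg (hg0 y)]; exact hgc y)
  have hcake (κ : Measure Y) [IsFiniteMeasure κ] :
      ∫ y, g y ∂κ = ∫ t in Set.Ioc 0 c, κ.real {y | t ≤ g y} :=
    (hint κ).integral_eq_integral_Ioc_meas_le (.of_forall hg0) (.of_forall hgc)
  have htail (κ : Measure Y) [IsFiniteMeasure κ] :
      IntegrableOn (fun t => κ.real {y | t ≤ g y}) (Set.Ioc 0 c) := by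
    have hanti : Antitone fun t => κ.real {y | t ≤ g y} := fun s t hst =>
      measureReal_mono fun y (hy : t ≤ g y) => hst.trans hy
    exact (hanti.antitoneOn _).integrableOn_isCompact isCompact_Icc |>.mono_set
      Set.Ioc_subset_Icc_self
  have hconst : IntegrableOn (fun _ : ℝ => δ) (Set.Ioc 0 c) := by simp
  calc ∫ y, g y ∂μ = ∫ t in Set.Ioc 0 c, μ.real {y | t ≤ g y} := hcake μ
    _ ≤ ∫ t in Set.Ioc 0 c, (a * ν.real {y | t ≤ g y} + δ) :=
      integral_mono (htail μ) (((htail ν).const_mul a).add hconst) fun t =>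
        h _ (measurableSet_le measurable_const hg)
    _ = a * ∫ y, g y ∂ν + c * δ := by
      rw [integral_add ((htail ν).const_mul a) hconst, integral_const_mul, ← hcake ν]
      simp [hc]

section MatrixTrace

variable {n : Type*} [Fintype n]

attribute [local instance] Matrix.frobeniusNormedAddCommGroup

theorem Matrix.re_trace_conjTranspose_mul_self_eq_frobenius_sq (B : Matrix n n ℂ) :
    (Bᴴ * B).trace.re = ‖B‖ ^ 2 := by
  rw [frobenius_norm_def, ← Real.sqrt_eq_rpow, Real.sq_sqrt (by positivity), Finset.sum_comm]
  simp [Matrix.trace, Matrix.mul_apply, ← Complex.normSq_eq_conj_mul_self, Complex.sq_norm]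

theorem Matrix.PosSemidef.exists_re_trace_mul_eq_frobenius_sq {P Q : Matrix n n ℂ}
    (hP : P.PosSemidef) (hQ : Q.PosSemidef) :
    ∃ B C : Matrix n n ℂ, P.trace.re = ‖B‖ ^ 2 ∧ Q.trace.re = ‖C‖ ^ 2 ∧
      (P * Q).trace.re = ‖B * Cᴴ‖ ^ 2 := by
  classical
  open scoped MatrixOrder in
  obtain ⟨B, rfl⟩ := CStarAlgebra.nonneg_iff_eq_star_mul_self.mp hP.nonneg
  open scoped MatrixOrder in
  obtain ⟨C, rfl⟩ := CStarAlgebra.nonneg_iff_eq_star_mul_self.mp hQ.nonneg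
  refine ⟨B, C, re_trace_conjTranspose_mul_self_eq_frobenius_sq B,
    re_trace_conjTranspose_mul_self_eq_frobenius_sq C, ?_⟩
  rw [← re_trace_conjTranspose_mul_self_eq_frobenius_sq, conjTranspose_mul,
    conjTranspose_conjTranspose, star_eq_conjTranspose, star_eq_conjTranspose,
    ← Matrix.mul_assoc, trace_mul_comm]
  simp only [Matrix.mul_assoc]

theorem Matrix.PosSemidef.re_trace_mul_nonneg {P Q : Matrix n n ℂ}
    (hP : P.PosSemidef) (hQ : Q.PosSemidef) : 0 ≤ (P * Q).trace.re := by
  obtain ⟨B, C, -, -, h⟩ := hP.exists_re_trace_mul_eq_frobenius_sq hQ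
  exact h ▸ sq_nonneg _

theorem Matrix.PosSemidef.re_trace_mul_le {P Q : Matrix n n ℂ}
    (hP : P.PosSemidef) (hQ : Q.PosSemidef) :
    (P * Q).trace.re ≤ P.trace.re * Q.trace.re := by
  obtain ⟨B, C, hB, hC, h⟩ := hP.exists_re_trace_mul_eq_frobenius_sq hQ
  rw [h, hB, hC, ← mul_pow, ← frobenius_norm_conjTranspose C]
  gcongr
  exact frobenius_norm_mul B Cᴴ

/-- The acceptance probability of an effect `P` on a state `Q` is at most `min 1 (tr P)`. -/
theorem Matrix.PosSemidef.re_trace_mul_le_min [DecidableEq n] {P Q : Matrix n n ℂ}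
    (hP : P.PosSemidef) (hP1 : (1 - P).PosSemidef) (hQ : Q.PosSemidef) (hQ1 : Q.trace = 1) :
    (P * Q).trace.re ≤ min 1 P.trace.re := by
  refine le_min ?_ (by simpa [hQ1] using hP.re_trace_mul_le hQ)
  have h := hP1.re_trace_mul_nonneg hQ
  rw [Matrix.sub_mul, Matrix.one_mul, Matrix.trace_sub, hQ1] at h
  simpa using h

end MatrixTrace

/-- Privacy amplification of the failure probability under
depolarizing quantum post-processing. -/
theorem depolarizing_failure_amplification
    {X Y : Type*} [MeasurableSpace Y]
    (Adj : X → X → Prop)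
    (A : X → Measure Y)
    (hprob : ∀ x, IsProbabilityMeasure (A x))
    (ε δ : ℝ) (hε : 0 ≤ ε) (hδ0 : 0 ≤ δ) (hδ1 : δ ≤ 1)
    (hDP : ∀ x x', Adj x x' → ∀ S : Set Y, MeasurableSet S →
      ((A x) S).toReal ≤ Real.exp ε * ((A x') S).toReal + δ)
    (d : ℕ) (hd : 1 ≤ d)
    (f_enc : Y → Matrix (Fin d) (Fin d) ℂ)
    (hmeas : ∀ i j, Measurable fun y => f_enc y i j)
    (hdens : ∀ y, (f_enc y).PosSemidef ∧ (f_enc y).trace = 1)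
    (K : ℕ) (E : Fin K → Matrix (Fin d) (Fin d) ℂ)
    (hE : ∀ k, (E k).PosSemidef) (hEsum : ∑ k, E k = 1)
    (η : ℝ) (hη0 : 0 ≤ η) (hη1 : η ≤ 1)
    (M : X → Fin K → ℝ)
    (hM : ∀ x k, M x k = ∫ y,
      ((E k * (((1 - η : ℝ) : ℂ) • f_enc y +
        ((η / d : ℝ) : ℂ) • (1 : Matrix (Fin d) (Fin d) ℂ))).trace).re ∂(A x)) :
    ∀ x x', Adj x x' →
      ∑ k, max 0 (M x k - Real.exp ε * M x' k) ≤
        max 0 (η * (1 - Real.exp ε) / d + (1 - η) * δ) := by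
  intro x x' hadj
  have := hprob x
  have := hprob x'
  have hmeas_trace (P : Matrix (Fin d) (Fin d) ℂ) :
      Measurable fun y => (P * f_enc y).trace.re := by
    simp only [Matrix.trace, Matrix.diag, Matrix.mul_apply]
    fun_prop
  have hint (z : X) (k : Fin K) : Integrable (fun y => (E k * f_enc y).trace.re) (A z) := by
    have := hprob z
    refine .of_bound (hmeas_trace _).aestronglyMeasurable (E k).trace.re (.of_forall fun y => ?_)
    rw [Real.norm_of_nonneg ((hE k).re_trace_mul_nonneg (hdens y).1)]
    simpa [(hdens y).2] using (hE k).re_trace_mul_le (hdens y).1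
  have hM' (z : X) (k : Fin K) : M z k =
      (1 - η) * ∫ y, (E k * f_enc y).trace.re ∂(A z) + η / d * (E k).trace.re := by
    have := hprob z
    have heq (y : Y) : ((E k * (((1 - η : ℝ) : ℂ) • f_enc y +
        ((η / d : ℝ) : ℂ) • (1 : Matrix (Fin d) (Fin d) ℂ))).trace).re =
        (1 - η) * (E k * f_enc y).trace.re + η / d * (E k).trace.re := by
      rw [Matrix.mul_add, Matrix.mul_smul, Matrix.mul_smul, Matrix.mul_one, Matrix.trace_add,
        Matrix.trace_smul, Matrix.trace_smul, Complex.add_re, smul_eq_mul, smul_eq_mul,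
        Complex.re_ofReal_mul, Complex.re_ofReal_mul]
    simp_rw [hM, heq]
    rw [integral_add ((hint z k).const_mul _) (integrable_const _), integral_const_mul]
    simp
  set S : Finset (Fin K) := {k | 0 < M x k - Real.exp ε * M x' k} with hS
  set P := ∑ k ∈ S, E k with hP_def
  have hP : P.PosSemidef := posSemidef_sum _ fun k _ => hE k
  have hP1 : (1 - P).PosSemidef := by
    have : 1 - P = ∑ k ∈ Sᶜ, E k := by
      rw [← hEsum, ← Finset.sum_add_sum_compl S E, add_sub_cancel_left]
    exact this ▸ posSemidef_sum _ fun k _ => hE k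
  have hsumM (z : X) : ∑ k ∈ S, M z k =
      (1 - η) * ∫ y, (P * f_enc y).trace.re ∂(A z) + η / d * P.trace.re := by
    simp_rw [hM', Finset.sum_add_distrib, ← Finset.mul_sum]
    rw [← integral_finsetSum _ fun k _ => hint z k]
    simp_rw [hP_def, Finset.sum_mul, Matrix.trace_sum, Complex.re_sum]
  have hpos : ∑ k, max 0 (M x k - Real.exp ε * M x' k) =
      ∑ k ∈ S, M x k - Real.exp ε * ∑ k ∈ S, M x' k := by
    rw [Finset.mul_sum, ← Finset.sum_sub_distrib, hS, Finset.sum_filter]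
    refine Finset.sum_congr rfl fun k _ => ?_
    split_ifs with h
    · exact max_eq_right h.le
    · exact max_eq_left (not_lt.mp h)
  have ht0 : 0 ≤ P.trace.re := (Complex.nonneg_iff.mp hP.trace_nonneg).1
  have hc0 : 0 ≤ min 1 P.trace.re := le_min zero_le_one ht0
  have hDP_int := integral_le_mul_integral_add_of_measureReal_le (hDP x x' hadj) (hmeas_trace P)
    (fun y => hP.re_trace_mul_nonneg (hdens y).1)
    (fun y => hP.re_trace_mul_le_min hP1 (hdens y).1 (hdens y).2) hc0
  have hexp : 1 - Real.exp ε ≤ 0 := sub_nonpos.mpr (Real.one_le_exp hε)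
  have hneg : η / d * (1 - Real.exp ε) ≤ 0 := mul_nonpos_of_nonneg_of_nonpos (by positivity) hexp
  rw [hpos, hsumM, hsumM]
  calc _ = (1 - η) * (∫ y, (P * f_enc y).trace.re ∂(A x) -
          Real.exp ε * ∫ y, (P * f_enc y).trace.re ∂(A x')) +
        η / d * (1 - Real.exp ε) * P.trace.re := by ring
    _ ≤ (1 - η) * (min 1 P.trace.re * δ) + η / d * (1 - Real.exp ε) * min 1 P.trace.re :=
      add_le_add
        (mul_le_mul_of_nonneg_left (sub_le_iff_le_add'.mpr hDP_int) (sub_nonneg.mpr hη1))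
        (mul_le_mul_of_nonpos_left (min_le_right _ _) hneg)
    _ = min 1 P.trace.re * (η * (1 - Real.exp ε) / d + (1 - η) * δ) := by ring
    _ ≤ min 1 P.trace.re * max 0 (η * (1 - Real.exp ε) / d + (1 - η) * δ) := by
      gcongr; exact le_max_right _ _
    _ ≤ max 0 (η * (1 - Real.exp ε) / d + (1 - η) * δ) :=
      mul_le_of_le_one_left (le_max_left _ _) (min_le_left _ _)
end

section
/- Let ρ and ρ' be density matrices on ℂ^d, let {E_k}_{k=1}^K be a POVM on ℂ^d, and let α ≥ 0. Define the probability vectors P(k) = Tr(E_k ρ) and P'(k) = Tr(E_k ρ'). Then Σ_{k=1}^K max(0, P(k) − α P'(k)) ≤ Tr[(ρ − α ρ')₊], i.e. the classical hockey-stick divergence of the measurement outcome distributions is at most the quantum hockey-stick divergence of the states. -/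
open Matrix
open scoped ComplexOrder

/-- Trace of the positive part of a Hermitian matrix: the sum of the positive
parts of its eigenvalues (junk value `0` on non-Hermitian matrices). This equals
`Tr[A₊]`, where `A₊` is the positive part of `A` in the spectral decomposition. -/
noncomputable def posPartTrace {n : Type*} [Fintype n] [DecidableEq n]
    (A : Matrix n n ℂ) : ℝ :=
  if h : A.IsHermitian then ∑ i, max (h.eigenvalues i) 0 else 0

/-- The weight `⟨uᵢ, B uᵢ⟩` of a matrix `B` on the `i`-th vector of an eigenbasis of `A`. -/
noncomputable def eigenWeight {n : Type*} [Fintype n] [DecidableEq n]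
    {A : Matrix n n ℂ} (hA : A.IsHermitian) (B : Matrix n n ℂ) (i : n) : ℝ :=
  ((star (hA.eigenvectorUnitary : Matrix n n ℂ) * B *
    (hA.eigenvectorUnitary : Matrix n n ℂ)) i i).re

section eigenWeight

variable {n : Type*} [Fintype n] [DecidableEq n] {A : Matrix n n ℂ} (hA : A.IsHermitian)

theorem eigenWeight_nonneg {B : Matrix n n ℂ} (hB : B.PosSemidef) (i : n) :
    0 ≤ eigenWeight hA B i :=
  (Complex.le_def.mp
    (hB.conjTranspose_mul_mul_same (hA.eigenvectorUnitary : Matrix n n ℂ)).diag_nonneg).1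

theorem eigenWeight_one (i : n) : eigenWeight hA 1 i = 1 := by
  simp [eigenWeight]

theorem eigenWeight_sum {ι : Type*} (s : Finset ι) (B : ι → Matrix n n ℂ) (i : n) :
    eigenWeight hA (∑ k ∈ s, B k) i = ∑ k ∈ s, eigenWeight hA (B k) i := by
  simp only [eigenWeight, Finset.mul_sum, Finset.sum_mul, Matrix.sum_apply, Complex.re_sum]

theorem re_trace_mul_eq_sum_eigenWeight (B : Matrix n n ℂ) :
    (B * A).trace.re = ∑ i, hA.eigenvalues i * eigenWeight hA B i := by
  conv_lhs => rw [hA.spectral_theorem, Unitary.conjStarAlgAut_apply]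
  rw [← Matrix.mul_assoc, ← Matrix.mul_assoc, Matrix.trace_mul_comm, ← Matrix.mul_assoc,
    ← Matrix.mul_assoc]
  simp [Matrix.trace, Matrix.mul_diagonal, eigenWeight, mul_comm]

/-- Measuring a Hermitian matrix with a POVM yields total positive mass at most the trace of its
positive part. -/
theorem sum_max_re_trace_mul_le_posPartTrace {ι : Type*} [Fintype ι]
    (hA : A.IsHermitian) {E : ι → Matrix n n ℂ}
    (hE : ∀ k, (E k).PosSemidef) (hEsum : ∑ k, E k = 1) :
    ∑ k, max 0 (E k * A).trace.re ≤ posPartTrace A := by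
  rw [posPartTrace, dif_pos hA]
  calc ∑ k, max 0 (E k * A).trace.re
      ≤ ∑ k, ∑ i, max (hA.eigenvalues i) 0 * eigenWeight hA (E k) i := by
        refine Finset.sum_le_sum fun k _ => max_le ?_ ?_
        · exact Finset.sum_nonneg fun i _ =>
            mul_nonneg (le_max_right _ _) (eigenWeight_nonneg hA (hE k) i)
        · rw [re_trace_mul_eq_sum_eigenWeight hA]
          exact Finset.sum_le_sum fun i _ =>
            mul_le_mul_of_nonneg_right (le_max_left _ _) (eigenWeight_nonneg hA (hE k) i)
    _ = ∑ i, max (hA.eigenvalues i) 0 := by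
        rw [Finset.sum_comm]
        refine Finset.sum_congr rfl fun i _ => ?_
        rw [← Finset.mul_sum, ← eigenWeight_sum, hEsum, eigenWeight_one, mul_one]

end eigenWeight

/-- the classical hockey-stick divergence of the measurement
outcome distributions is at most the quantum hockey-stick divergence of the
states. -/
theorem classical_HS_le_quantum_HS
    (d : ℕ) (ρ ρ' : Matrix (Fin d) (Fin d) ℂ)
    (hρ : ρ.PosSemidef) (hρ1 : ρ.trace = 1)
    (hρ' : ρ'.PosSemidef) (hρ'1 : ρ'.trace = 1)
    (K : ℕ) (E : Fin K → Matrix (Fin d) (Fin d) ℂ)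
    (hE : ∀ k, (E k).PosSemidef) (hEsum : ∑ k, E k = 1)
    (α : ℝ) (hα : 0 ≤ α) :
    ∑ k, max 0 (((E k * ρ).trace).re - α * ((E k * ρ').trace).re) ≤
      posPartTrace (ρ - (α : ℂ) • ρ') := by
  have hA : (ρ - (α : ℂ) • ρ').IsHermitian :=
    hρ.isHermitian.sub (hρ'.smul (Complex.zero_le_real.mpr hα)).isHermitian
  simpa [Matrix.mul_sub, Matrix.trace_sub] using
    sum_max_re_trace_mul_le_posPartTrace hA hE hEsum
end

section
/- Let ρ and ρ' be density matrices on ℂ^d, let η ∈ [0,1], α ≥ 1, and let f_dep^{(η)}(ρ) = (1−η)ρ + η I/d be the depolarizing channel. Then Tr[(f_dep^{(η)}(ρ) − α f_dep^{(η)}(ρ'))₊] ≤ max(0, (1−α)·η/d + (1−η)·Tr[(ρ − α ρ')₊]). -/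
open Matrix
open scoped ComplexOrder

/-- The depolarizing channel with parameter `η` on `d`-dimensional states. -/
noncomputable def depolarize (d : ℕ) (η : ℝ) (ρ : Matrix (Fin d) (Fin d) ℂ) :
    Matrix (Fin d) (Fin d) ℂ :=
  ((1 - η : ℝ) : ℂ) • ρ + ((η / d : ℝ) : ℂ) • (1 : Matrix (Fin d) (Fin d) ℂ)

/-- The spectrum of an affine image `a • A + c • 1` of a Hermitian matrix, with multiplicity. -/
lemma Matrix.IsHermitian.roots_charpoly_smul_add_smul_one {n : Type*} [Fintype n] [DecidableEq n]
    {A : Matrix n n ℂ} (hA : A.IsHermitian) (a c : ℝ) :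
    ((a : ℂ) • A + (c : ℂ) • (1 : Matrix n n ℂ)).charpoly.roots =
      Finset.univ.val.map fun i => ((a * hA.eigenvalues i + c : ℝ) : ℂ) := by
  have h : (a : ℂ) • A + (c : ℂ) • (1 : Matrix n n ℂ) =
      cfc (fun x : ℝ => a * x + c) A := by
    conv_lhs => rw [hA.spectral_theorem]
    rw [hA.cfc_eq, Matrix.IsHermitian.cfc, ← map_smul,
      ← map_one (Unitary.conjStarAlgAut ℂ _ hA.eigenvectorUnitary), ← map_smul, ← map_add]
    congr 1
    ext i j
    by_cases hij : i = j
    · subst hij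
      simp
    · simp [hij]
  rw [h, hA.charpoly_cfc_eq, Polynomial.roots_prod]
  · simp only [Polynomial.roots_X_sub_C, Multiset.bind_singleton]
    rfl
  · exact Finset.prod_ne_zero_iff.mpr fun i _ => Polynomial.X_sub_C_ne_zero _

lemma posPartTrace_smul_add_smul_one {n : Type*} [Fintype n] [DecidableEq n]
    {A : Matrix n n ℂ} (hA : A.IsHermitian) (a c : ℝ) :
    posPartTrace ((a : ℂ) • A + (c : ℂ) • (1 : Matrix n n ℂ)) =
      ∑ i, max (a * hA.eigenvalues i + c) 0 := by
  have hM : ((a : ℂ) • A + (c : ℂ) • (1 : Matrix n n ℂ)).IsHermitian := by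
    simp [Matrix.IsHermitian, hA.eq]
  have h := hM.roots_charpoly_eq_eigenvalues
  rw [hA.roots_charpoly_smul_add_smul_one] at h
  have h' := congrArg (fun s : Multiset ℂ => (s.map fun z => max z.re 0).sum) h
  rw [posPartTrace, dif_pos hM]
  simpa [Multiset.map_map, Function.comp_def] using h'.symm

/-- A nonpositive shift either kills every positive part or is felt by at least one of them. -/
lemma sum_max_mul_add_le {ι : Type*} [Fintype ι] (x : ι → ℝ) {a c : ℝ} (ha : 0 ≤ a) (hc : c ≤ 0) :
    ∑ i, max (a * x i + c) 0 ≤ max 0 (c + a * ∑ i, max (x i) 0) := by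
  classical
  have hle (i : ι) : max (a * x i + c) 0 ≤ a * max (x i) 0 := by
    rcases max_cases (x i) 0 with h | h <;> rw [h.1] <;> apply max_le <;> nlinarith
  by_cases hp : ∃ j, 0 < a * x j + c
  · obtain ⟨j, hj⟩ := hp
    apply le_max_of_le_right
    have hj' : max (a * x j + c) 0 ≤ c + a * max (x j) 0 := by
      rw [max_eq_left hj.le]
      nlinarith [mul_le_mul_of_nonneg_left (le_max_left (x j) 0) ha]
    rw [← Finset.add_sum_erase _ _ (Finset.mem_univ j),
      ← Finset.add_sum_erase _ (fun i => max (x i) 0) (Finset.mem_univ j), mul_add, ← add_assoc,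
      Finset.mul_sum]
    exact add_le_add hj' (Finset.sum_le_sum fun i _ => hle i)
  · push Not at hp
    apply le_max_of_le_left
    exact Finset.sum_nonpos fun i _ => max_le (hp i) le_rfl

/-- contraction of the quantum hockey-stick divergence under the
depolarizing channel. -/
theorem quantum_HS_contraction_depolarizing
    (d : ℕ) (ρ ρ' : Matrix (Fin d) (Fin d) ℂ)
    (hρ : ρ.PosSemidef) (hρ1 : ρ.trace = 1)
    (hρ' : ρ'.PosSemidef) (hρ'1 : ρ'.trace = 1)
    (η α : ℝ) (hη0 : 0 ≤ η) (hη1 : η ≤ 1) (hα : 1 ≤ α) :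
    posPartTrace (depolarize d η ρ - (α : ℂ) • depolarize d η ρ') ≤
      max 0 ((1 - α) * η / d + (1 - η) * posPartTrace (ρ - (α : ℂ) • ρ')) := by
  have hA : (ρ - (α : ℂ) • ρ').IsHermitian := by
    simp [Matrix.IsHermitian, hρ.isHermitian.eq, hρ'.isHermitian.eq]
  have hM : depolarize d η ρ - (α : ℂ) • depolarize d η ρ' =
      ((1 - η : ℝ) : ℂ) • (ρ - (α : ℂ) • ρ') +
        (((1 - α) * η / d : ℝ) : ℂ) • (1 : Matrix (Fin d) (Fin d) ℂ) := by
    simp only [depolarize]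
    push_cast
    module
  have hc : (1 - α) * η / d ≤ 0 :=
    div_nonpos_of_nonpos_of_nonneg (mul_nonpos_of_nonpos_of_nonneg (by linarith) hη0)
      d.cast_nonneg
  rw [hM, posPartTrace_smul_add_smul_one hA, posPartTrace, dif_pos hA]
  exact sum_max_mul_add_le _ (by linarith) hc
end
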